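/- The sequence EK_• of free R-modules and maps is a complex (d_EK ∘ d_EK = 0) and is a minimal homogeneous free resolution of R/(x_1,…,x_n)^d. -/

import Mathlib

open Finset MvPolynomial

noncomputable section

variable (K : Type) [Field K] (n : ℕ)

abbrev Rp : Type := MvPolynomial (Fin n) K

/-- A multiset of size `d+1` over `Fin n` is nonempty. -/
lemma symNe {d : ℕ} (m : Sym (Fin n) (d+1)) :
    (m : Multiset (Fin n)).toFinset.Nonempty := by
  rw [Multiset.toFinset_nonempty]
  intro h
  have hm := Sym.card_coe (s := m)
  rw [h] at hm
  simp at hm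

/-- The largest entry `j_d` of a (sorted) nonempty row `j_1 ≤ ⋯ ≤ j_d`. -/
def maxSym {d : ℕ} (m : Sym (Fin n) (d+1)) : Fin n :=
  (m : Multiset (Fin n)).toFinset.max' (symNe n m)

lemma maxSym_mem {d : ℕ} (m : Sym (Fin n) (d+1)) :
    maxSym n m ∈ (m : Multiset (Fin n)) :=
  Multiset.mem_toFinset.mp (Finset.max'_mem _ (symNe n m))

/-- The smallest entry `j_1` of a (sorted) nonempty row `j_1 ≤ ⋯ ≤ j_d`. -/
def minSym {d : ℕ} (m : Sym (Fin n) (d+1)) : Fin n :=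
  (m : Multiset (Fin n)).toFinset.min' (symNe n m)

lemma minSym_mem {d : ℕ} (m : Sym (Fin n) (d+1)) :
    minSym n m ∈ (m : Multiset (Fin n)) :=
  Multiset.mem_toFinset.mp (Finset.min'_mem _ (symNe n m))

/-- Basis index set for `EK_{k+1}`: hook tableaux with strictly increasing column
entries `i_1 < ⋯ < i_k` (a `k`-element subset) and row entries `j_1 ≤ ⋯ ≤ j_d`
(a multiset of size `d`, here `d = d+1 ≥ 1`), subject to `i_k < j_d`. -/
def EKIdx (d k : ℕ) : Type :=
  {p : Finset (Fin n) × Sym (Fin n) (d+1) //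
    p.1.card = k ∧ ∀ i ∈ p.1, i < maxSym n p.2}

/-- The terms of the complex `EK_•`: `EK_0 = R` and `EK_{k+1}` is free on the hook
tableaux above. -/
def EKmod (d : ℕ) : ℕ → Type
  | 0 => Rp K n
  | k+1 => EKIdx n d k →₀ Rp K n

instance (d : ℕ) : (k : ℕ) → AddCommGroup (EKmod K n d k)
  | 0 => inferInstanceAs (AddCommGroup (Rp K n))
  | k+1 => inferInstanceAs (AddCommGroup (EKIdx n d k →₀ Rp K n))

instance (d : ℕ) : (k : ℕ) → Module (Rp K n) (EKmod K n d k)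
  | 0 => inferInstanceAs (Module (Rp K n) (Rp K n))
  | k+1 => inferInstanceAs (Module (Rp K n) (EKIdx n d k →₀ Rp K n))

/-- The tableau with column `s` and row `m`, as a basis element of `EK_{k+1}` if it is
a legal tableau (column of size `k`, all column entries < largest row entry), and `0`
otherwise (the standard Eliahou–Kervaire convention for illegal symbols). -/
def ekOf (d k : ℕ) (s : Finset (Fin n)) (m : Sym (Fin n) (d+1)) : EKIdx n d k →₀ Rp K n :=
  if h : s.card = k ∧ ∀ i ∈ s, i < maxSym n m then Finsupp.single ⟨(s, m), h⟩ 1 else 0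

/-- The row `m` with its largest entry `j_d` removed and `i` inserted:
the row of the tableau `(T ∖ {i_ℓ, j_d})^{i_ℓ}`. -/
def rowSwap {d : ℕ} (i : Fin n) (m : Sym (Fin n) (d+1)) : Sym (Fin n) (d+1) :=
  ⟨i ::ₘ (m : Multiset (Fin n)).erase (maxSym n m), by
    rw [Multiset.card_cons, Multiset.card_erase_of_mem (maxSym_mem n m), Sym.card_coe]; rfl⟩

/-- The monomial `x_{j_1} ⋯ x_{j_r}` attached to a multiset of indices. -/
def mprod (m : Multiset (Fin n)) : Rp K n := (m.map (fun i => X i)).prod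

/-- The Eliahou–Kervaire differential `d_EK : EK_{k+1} → EK_k` (in the reformulation by
Young tableaux): a single-row tableau is sent to its monomial `x_{j_1} ⋯ x_{j_d}`, and
for `k > 0` a tableau `T` is sent to
`Σ_ℓ (-1)^ℓ x_{i_ℓ} (T∖i_ℓ) - Σ_ℓ (-1)^ℓ x_{j_d} (T∖{i_ℓ,j_d})^{i_ℓ}`. -/
def dEK (d : ℕ) : (k : ℕ) → EKmod K n d (k+1) →ₗ[Rp K n] EKmod K n d k
  | 0 => Finsupp.lift _ _ _ fun p => mprod K n (p.1.2 : Multiset (Fin n))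
  | k+1 => Finsupp.lift _ _ _ fun p =>
      (∑ i ∈ p.1.1.attach,
        (((-1 : Rp K n) ^ ((p.1.1.filter (fun j => j < i.1)).card + 1)) * X i.1) •
          ekOf K n d k (p.1.1.erase i.1) p.1.2)
      - (∑ i ∈ p.1.1.attach,
        (((-1 : Rp K n) ^ ((p.1.1.filter (fun j => j < i.1)).card + 1)) *
            X (maxSym n p.1.2)) •
          ekOf K n d k (p.1.1.erase i.1) (rowSwap n i.1 p.1.2))


/-! ### Helpers -/

lemma le_maxSym {d : ℕ} (m : Sym (Fin n) (d+1)) {i : Fin n} (h : i ∈ (m : Multiset (Fin n))) :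
    i ≤ maxSym n m := Finset.le_max' _ _ (Multiset.mem_toFinset.mpr h)

lemma maxSym_le {d : ℕ} (m : Sym (Fin n) (d+1)) {j : Fin n}
    (h : ∀ i ∈ (m : Multiset (Fin n)), i ≤ j) :
    maxSym n m ≤ j := h _ (maxSym_mem n m)

lemma red_aux {m1 m2 b1 b2 : Multiset (Fin n)} (hm1 : m1 ≠ 0) (hm2 : m2 ≠ 0)
    (hc : m1.card = m2.card)
    (h1 : ∀ x ∈ b1, ∀ y ∈ m1, y ≤ x) (h2 : ∀ x ∈ b2, ∀ y ∈ m2, y ≤ x)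
    (h : b1 + m1 = b2 + m2) : m1 = m2 := by
  obtain ⟨M1, hM1, hM1'⟩ : ∃ M ∈ m1, ∀ y ∈ m1, y ≤ M := by
    have hne : m1.toFinset.Nonempty := by simpa using hm1
    exact ⟨m1.toFinset.max' hne, Multiset.mem_toFinset.mp (Finset.max'_mem _ _),
      fun y hy => Finset.le_max' _ _ (Multiset.mem_toFinset.mpr hy)⟩
  obtain ⟨M2, hM2, hM2'⟩ : ∃ M ∈ m2, ∀ y ∈ m2, y ≤ M := by
    have hne : m2.toFinset.Nonempty := by simpa using hm2
    exact ⟨m2.toFinset.max' hne, Multiset.mem_toFinset.mp (Finset.max'_mem _ _),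
      fun y hy => Finset.le_max' _ _ (Multiset.mem_toFinset.mpr hy)⟩
  have hcount : ∀ i, b1.count i + m1.count i = b2.count i + m2.count i := by
    intro i
    rw [← Multiset.count_add, ← Multiset.count_add, h]
  have hb1 : ∀ i, i < M1 → b1.count i = 0 := fun i hi =>
    Multiset.count_eq_zero.mpr fun hb => absurd (h1 i hb M1 hM1) (not_le.mpr hi)
  have hb2 : ∀ i, i < M2 → b2.count i = 0 := fun i hi =>
    Multiset.count_eq_zero.mpr fun hb => absurd (h2 i hb M2 hM2) (not_le.mpr hi)
  have hz1 : ∀ i, M1 < i → m1.count i = 0 := fun i hi =>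
    Multiset.count_eq_zero.mpr fun hb => absurd (hM1' i hb) (not_le.mpr hi)
  have hz2 : ∀ i, M2 < i → m2.count i = 0 := fun i hi =>
    Multiset.count_eq_zero.mpr fun hb => absurd (hM2' i hb) (not_le.mpr hi)
  have key : m1 ≤ m2 ∨ m2 ≤ m1 := by
    rcases lt_trichotomy M1 M2 with hlt | heq | hlt
    · left
      rw [Multiset.le_iff_count]
      intro i
      have := hcount i
      rcases lt_or_ge i M2 with hi | hi
      · have := hb2 i hi; omega
      · have := hz1 i (lt_of_lt_of_le hlt hi); omega
    · subst heq
      have hne : ∀ i, i ≠ M1 → m1.count i = m2.count i := by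
        intro i hi
        have := hcount i
        rcases lt_or_gt_of_ne hi with hi | hi
        · have := hb1 i hi; have := hb2 i hi; omega
        · have := hz1 i hi; have := hz2 i hi; omega
      rcases le_total (m1.count M1) (m2.count M1) with hh | hh
      · left
        rw [Multiset.le_iff_count]
        intro i
        by_cases hi : i = M1
        · rw [hi]; exact hh
        · exact (hne i hi).le
      · right
        rw [Multiset.le_iff_count]
        intro i
        by_cases hi : i = M1
        · rw [hi]; exact hh
        · exact (hne i hi).ge
    · right
      rw [Multiset.le_iff_count]
      intro i
      have := hcount i
      rcases lt_or_ge i M1 with hi | hi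
      · have := hb1 i hi; omega
      · have := hz2 i (lt_of_lt_of_le hlt hi); omega
  rcases key with hk | hk
  · exact Multiset.eq_of_le_of_card_le hk hc.ge
  · exact (Multiset.eq_of_le_of_card_le hk hc.le).symm

lemma sym_ne_zero {d : ℕ} (m : Sym (Fin n) (d+1)) : (m : Multiset (Fin n)) ≠ 0 := by
  simpa using symNe n m

def gB {d : ℕ} (i : Fin n) (m : Sym (Fin n) (d+1)) : Sym (Fin n) (d+1) :=
  if i < maxSym n m then rowSwap n i m else m

def yB {d : ℕ} (i : Fin n) (m : Sym (Fin n) (d+1)) : Fin n :=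
  if i < maxSym n m then maxSym n m else i

lemma rowSwap_coe {d : ℕ} (i : Fin n) (m : Sym (Fin n) (d+1)) :
    (rowSwap n i m : Multiset (Fin n)) = i ::ₘ (m : Multiset (Fin n)).erase (maxSym n m) := rfl

lemma gB_total {d : ℕ} (i : Fin n) (m : Sym (Fin n) (d+1)) :
    yB n i m ::ₘ (gB n i m : Multiset (Fin n)) = i ::ₘ (m : Multiset (Fin n)) := by
  unfold yB gB
  split_ifs with h
  · rw [rowSwap_coe, Multiset.cons_swap, Multiset.cons_erase (maxSym_mem n m)]
  · rfl

lemma gB_le_yB {d : ℕ} (i : Fin n) (m : Sym (Fin n) (d+1)) :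
    ∀ y ∈ i ::ₘ (m : Multiset (Fin n)), y ≤ yB n i m := by
  intro y hy
  unfold yB
  rcases Multiset.mem_cons.mp hy with rfl | hy
  · split_ifs with h
    · exact h.le
    · exact le_rfl
  · have := le_maxSym n m hy
    split_ifs with h
    · exact this
    · exact this.trans (not_lt.mp h)

lemma gB_sub {d : ℕ} (i : Fin n) (m : Sym (Fin n) (d+1)) {y : Fin n}
    (hy : y ∈ (gB n i m : Multiset (Fin n))) : y ∈ i ::ₘ (m : Multiset (Fin n)) := by
  rw [← gB_total]; exact Multiset.mem_cons_of_mem hy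

lemma gB_gB_le {d : ℕ} (i j : Fin n) (m : Sym (Fin n) (d+1)) {y : Fin n}
    (hy : y ∈ (gB n j (gB n i m) : Multiset (Fin n))) : y ≤ yB n i m := by
  by_cases hj : j < maxSym n (gB n i m)
  · rcases Multiset.mem_cons.mp (gB_sub n j _ hy) with rfl | h
    · exact hj.le.trans (gB_le_yB n i m _ (gB_sub n i m (maxSym_mem n _)))
    · exact gB_le_yB n i m _ (gB_sub n i m h)
  · have : gB n j (gB n i m) = gB n i m := by rw [gB, if_neg hj]
    rw [this] at hy
    exact gB_le_yB n i m _ (gB_sub n i m hy)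

lemma gB_comm {d : ℕ} (i j : Fin n) (m : Sym (Fin n) (d+1)) :
    gB n j (gB n i m) = gB n i (gB n j m) ∧
    ({yB n i m, yB n j (gB n i m)} : Multiset (Fin n)) = {yB n j m, yB n i (gB n j m)} := by
  have tot : ∀ i j : Fin n, ({yB n i m, yB n j (gB n i m)} : Multiset (Fin n)) +
      (gB n j (gB n i m) : Multiset (Fin n)) = i ::ₘ j ::ₘ (m : Multiset (Fin n)) := by
    intro i j
    rw [Multiset.insert_eq_cons, Multiset.cons_add, Multiset.singleton_add, gB_total,
      Multiset.cons_swap, gB_total, Multiset.cons_swap]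
  have hle : ∀ i j : Fin n, ∀ x ∈ ({yB n i m, yB n j (gB n i m)} : Multiset (Fin n)),
      ∀ y ∈ (gB n j (gB n i m) : Multiset (Fin n)), y ≤ x := by
    intro i j x hx y hy
    rw [Multiset.insert_eq_cons, Multiset.mem_cons, Multiset.mem_singleton] at hx
    rcases hx with rfl | rfl
    · exact gB_gB_le n i j m hy
    · exact gB_le_yB n j _ _ (gB_sub n j _ hy)
  have ht : ({yB n i m, yB n j (gB n i m)} : Multiset (Fin n)) +
      (gB n j (gB n i m) : Multiset (Fin n)) = ({yB n j m, yB n i (gB n j m)} : Multiset (Fin n)) +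
      (gB n i (gB n j m) : Multiset (Fin n)) := by
    rw [tot, tot, Multiset.cons_swap]
  have h := red_aux n (sym_ne_zero n _) (sym_ne_zero n _) (by simp) (hle i j) (hle j i) ht
  refine ⟨Sym.coe_injective h, ?_⟩
  rw [h] at ht
  exact add_right_cancel ht

lemma yB_comm {d : ℕ} (i j : Fin n) (m : Sym (Fin n) (d+1)) :
    (X (yB n i m) * X (yB n j (gB n i m)) : Rp K n) = X (yB n j m) * X (yB n i (gB n j m)) := by
  have := congrArg (fun s : Multiset (Fin n) => (s.map (X : Fin n → Rp K n)).prod)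
    (gB_comm n i j m).2
  simpa using this

lemma maxSym_gB_le {d : ℕ} (i : Fin n) (m : Sym (Fin n) (d+1)) :
    maxSym n (gB n i m) ≤ maxSym n m := by
  unfold gB
  split_ifs with h
  · apply maxSym_le
    intro y hy
    rw [rowSwap_coe, Multiset.mem_cons] at hy
    rcases hy with rfl | hy
    · exact h.le
    · exact le_maxSym n m (Multiset.mem_of_mem_erase hy)
  · exact le_rfl

/-! ### Differentials -/

abbrev Ek (d k : ℕ) : Type := EKIdx n d k →₀ Rp K n

def dZ (d : ℕ) : Ek K n d 0 →ₗ[Rp K n] Rp K n := dEK K n d 0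
def dS (d k : ℕ) : Ek K n d (k+1) →ₗ[Rp K n] Ek K n d k := dEK K n d (k+1)

def sg (s : Finset (Fin n)) (i : Fin n) : Rp K n := (-1) ^ ((s.filter (fun j => j < i)).card + 1)

lemma ekOf_legal (d k : ℕ) (p : EKIdx n d k) : ekOf K n d k p.1.1 p.1.2 = Finsupp.single p 1 := by
  unfold ekOf
  rw [dif_pos p.2]; rfl

lemma ekOf_zero (d k : ℕ) (s : Finset (Fin n)) (m : Sym (Fin n) (d+1))
    (h : ¬ (s.card = k ∧ ∀ i ∈ s, i < maxSym n m)) : ekOf K n d k s m = 0 := by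
  unfold ekOf
  rw [dif_neg h]

lemma lift_single_one {ι M R : Type*} [CommSemiring R] [AddCommMonoid M] [Module R M] (f : ι → M) (p : ι) :
    Finsupp.lift M R ι f (Finsupp.single p 1) = f p := by
  simp [Finsupp.lift_apply]

lemma dZ_single (d : ℕ) (p : EKIdx n d 0) :
    dZ K n d (Finsupp.single p 1) = mprod K n (p.1.2 : Multiset (Fin n)) :=
  lift_single_one (R := Rp K n) (M := Rp K n)
    (fun p : EKIdx n d 0 => mprod K n (p.1.2 : Multiset (Fin n))) p

def mkI (d k : ℕ) (s : Finset (Fin n)) (m : Sym (Fin n) (d+1))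
    (h : s.card = k ∧ ∀ i ∈ s, i < maxSym n m) : EKIdx n d k := ⟨(s, m), h⟩

lemma ekOf_mkI (d k : ℕ) (s : Finset (Fin n)) (m : Sym (Fin n) (d+1))
    (h : s.card = k ∧ ∀ i ∈ s, i < maxSym n m) :
    ekOf K n d k s m = Finsupp.single (mkI n d k s m h) 1 :=
  ekOf_legal K n d k (mkI n d k s m h)

lemma dZ_ekOf (d : ℕ) (m : Sym (Fin n) (d+1)) : dZ K n d (ekOf K n d 0 ∅ m) = mprod K n m := by
  have h : (∅ : Finset (Fin n)).card = 0 ∧ ∀ i ∈ (∅ : Finset (Fin n)), i < maxSym n m := by simp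
  rw [ekOf_mkI K n d 0 ∅ m h, dZ_single]
  rfl

lemma dS_single (d k : ℕ) (p : EKIdx n d (k+1)) : dS K n d k (Finsupp.single p 1) =
    (∑ i ∈ p.1.1, (sg K n p.1.1 i * X i) • ekOf K n d k (p.1.1.erase i) p.1.2)
    - ∑ i ∈ p.1.1, (sg K n p.1.1 i * X (maxSym n p.1.2)) •
        ekOf K n d k (p.1.1.erase i) (rowSwap n i p.1.2) := by
  have : dS K n d k (Finsupp.single p 1) = (∑ i ∈ p.1.1.attach,
        (((-1 : Rp K n) ^ ((p.1.1.filter (fun j => j < i.1)).card + 1)) * X i.1) •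
          ekOf K n d k (p.1.1.erase i.1) p.1.2)
      - (∑ i ∈ p.1.1.attach,
        (((-1 : Rp K n) ^ ((p.1.1.filter (fun j => j < i.1)).card + 1)) *
            X (maxSym n p.1.2)) •
          ekOf K n d k (p.1.1.erase i.1) (rowSwap n i.1 p.1.2)) := by
    exact lift_single_one (R := Rp K n) (M := Ek K n d k) (fun p : EKIdx n d (k+1) =>
      (∑ i ∈ p.1.1.attach,
        (((-1 : Rp K n) ^ ((p.1.1.filter (fun j => j < i.1)).card + 1)) * X i.1) •
          ekOf K n d k (p.1.1.erase i.1) p.1.2)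
      - (∑ i ∈ p.1.1.attach,
        (((-1 : Rp K n) ^ ((p.1.1.filter (fun j => j < i.1)).card + 1)) *
            X (maxSym n p.1.2)) •
          ekOf K n d k (p.1.1.erase i.1) (rowSwap n i.1 p.1.2))) p
  rw [this]
  unfold sg
  congr 1
  · exact Finset.sum_attach p.1.1 (fun i => (((-1 : Rp K n) ^ ((p.1.1.filter (fun j => j < i)).card + 1)) * X i) •
          ekOf K n d k (p.1.1.erase i) p.1.2)
  · exact Finset.sum_attach p.1.1 (fun i => (((-1 : Rp K n) ^ ((p.1.1.filter (fun j => j < i)).card + 1)) *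
            X (maxSym n p.1.2)) •
          ekOf K n d k (p.1.1.erase i) (rowSwap n i p.1.2))

lemma dS_legal (d k : ℕ) (s : Finset (Fin n)) (m : Sym (Fin n) (d+1))
    (h : s.card = k+1 ∧ ∀ i ∈ s, i < maxSym n m) : dS K n d k (ekOf K n d (k+1) s m) =
    (∑ i ∈ s, (sg K n s i * X i) • ekOf K n d k (s.erase i) m)
    - ∑ i ∈ s, (sg K n s i * X (maxSym n m)) •
        ekOf K n d k (s.erase i) (rowSwap n i m) := by
  rw [ekOf_mkI K n d (k+1) s m h, dS_single]
  rfl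

lemma dS_ekOf (d k : ℕ) (s : Finset (Fin n)) (m : Sym (Fin n) (d+1)) :
    dS K n d k (ekOf K n d (k+1) s m) =
    ∑ i ∈ s, sg K n s i • ((X i : Rp K n) • ekOf K n d k (s.erase i) m
      - (X (yB n i m) : Rp K n) • ekOf K n d k (s.erase i) (gB n i m)) := by
  by_cases h : s.card = k+1 ∧ ∀ i ∈ s, i < maxSym n m
  · rw [dS_legal K n d k s m h, ← Finset.sum_sub_distrib]
    refine Finset.sum_congr rfl fun i hi => ?_
    rw [yB, gB, if_pos (h.2 i hi), if_pos (h.2 i hi), smul_sub, smul_smul, smul_smul]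
  · rw [ekOf_zero _ _ _ _ _ _ h, map_zero]
    symm
    refine Finset.sum_eq_zero fun i hi => ?_
    by_cases hc : s.card = k+1
    · have h' : ∃ i0 ∈ s, maxSym n m ≤ i0 := by
        by_contra hcon
        push Not at hcon
        exact h ⟨hc, hcon⟩
      obtain ⟨i0, hi0, hle⟩ := h'
      by_cases hii : i = i0
      · subst hii
        rw [yB, gB, if_neg (not_lt.mpr hle), if_neg (not_lt.mpr hle), sub_self, smul_zero]
      · have hmem : i0 ∈ s.erase i := Finset.mem_erase.mpr ⟨Ne.symm hii, hi0⟩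
        rw [ekOf_zero K n d k (s.erase i) m, ekOf_zero K n d k (s.erase i) (gB n i m)]
        · simp
        · exact fun hh => absurd (hh.2 i0 hmem) (not_lt.mpr ((maxSym_gB_le n i m).trans hle))
        · exact fun hh => absurd (hh.2 i0 hmem) (not_lt.mpr hle)
    · have hc' : (s.erase i).card ≠ k := by
        rw [Finset.card_erase_of_mem hi]
        have := Finset.card_pos.mpr ⟨i, hi⟩
        omega
      rw [ekOf_zero K n d k (s.erase i) m, ekOf_zero K n d k (s.erase i) (gB n i m)]
      · simp
      · exact fun hh => hc' hh.1
      · exact fun hh => hc' hh.1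

lemma sg_erase_lt (s : Finset (Fin n)) {i j : Fin n} (hj : j ∈ s) (h : j < i) :
    sg K n (s.erase j) i = - sg K n s i := by
  unfold sg
  rw [Finset.filter_erase, Finset.card_erase_of_mem (by simp [hj, h])]
  have : 0 < (s.filter (fun x => x < i)).card := Finset.card_pos.mpr ⟨j, by simp [hj, h]⟩
  obtain ⟨c, hc⟩ := Nat.exists_eq_succ_of_ne_zero this.ne'
  rw [hc]
  simp [pow_succ]

lemma sg_erase_ge (s : Finset (Fin n)) {i j : Fin n} (h : ¬ j < i) :
    sg K n (s.erase j) i = sg K n s i := by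
  unfold sg
  rw [Finset.filter_erase, Finset.erase_eq_of_notMem (by simp [h])]

lemma sg_anti (s : Finset (Fin n)) {i j : Fin n} (hi : i ∈ s) (hj : j ∈ s) (h : i ≠ j) :
    sg K n s i * sg K n (s.erase i) j + sg K n s j * sg K n (s.erase j) i = 0 := by
  rcases lt_or_gt_of_ne h with h | h
  · rw [sg_erase_lt K n s hi h, sg_erase_ge K n s (not_lt.mpr h.le)]; ring
  · rw [sg_erase_lt K n s hj h, sg_erase_ge K n s (not_lt.mpr h.le)]; ring

lemma dS_dS (d k : ℕ) : (dS K n d k).comp (dS K n d (k+1)) = 0 := by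
  refine Finsupp.lhom_ext' fun p => LinearMap.ext_ring ?_
  simp only [LinearMap.comp_apply, Finsupp.lsingle_apply, LinearMap.zero_apply]
  rw [← ekOf_legal]
  generalize p.1.1 = s
  generalize p.1.2 = m
  rw [dS_ekOf]
  simp only [map_sum, map_smul, map_sub, dS_ekOf, Finset.smul_sum, ← Finset.sum_sub_distrib]
  rw [Finset.sum_sigma']
  refine Finset.sum_involution (fun a _ => ⟨a.2, a.1⟩) ?_ ?_ ?_ ?_
  · rintro ⟨i, j⟩ hij
    simp only [Finset.mem_sigma, Finset.mem_erase] at hij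
    obtain ⟨hi, hji, hj⟩ := hij
    have h1 := sg_anti K n s hi hj hji.symm
    have h2 := yB_comm K n i j m
    have h3 := (gB_comm n i j m).1
    have h4 : (s.erase i).erase j = (s.erase j).erase i := Finset.erase_right_comm
    simp only
    rw [h3, h4]
    generalize ekOf K n d k ((s.erase j).erase i) = E
    set u := sg K n s i
    set u' := sg K n s j
    set v := sg K n (s.erase i) j
    set v' := sg K n (s.erase j) i
    have e : u' * v' = - (u * v) := by linear_combination h1
    set Y1 := (X (yB n i m) : Rp K n)
    set Y2 := (X (yB n j m) : Rp K n)
    set Z1 := (X (yB n j (gB n i m)) : Rp K n)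
    set Z2 := (X (yB n i (gB n j m)) : Rp K n)
    have f : ∀ (a b c e f g : Rp K n) (A B C D : Ek K n d k),
      a • (b • c • (e • A - f • B) - g • c • (e • C - D)) =
        (a*c) • ((b * e) • A - (b * f) • B - (g * e) • C + g • D) := by
      intros; module
    rw [f, f, e, smul_smul, smul_smul, h2]
    module
  · rintro ⟨i, j⟩ hij _ hne
    simp only [Finset.mem_sigma, Finset.mem_erase] at hij
    simp only [Sigma.mk.injEq] at hne
    exact hij.2.1 hne.1
  · rintro ⟨i, j⟩ hij
    simp only [Finset.mem_sigma, Finset.mem_erase] at hij ⊢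
    exact ⟨hij.2.2, hij.2.1.symm, hij.1⟩
  · rintro ⟨i, j⟩ hij
    rfl

lemma dZ_dS (d : ℕ) : (dZ K n d).comp (dS K n d 0) = 0 := by
  refine Finsupp.lhom_ext' fun p => LinearMap.ext_ring ?_
  change dZ K n d (dS K n d 0 (Finsupp.single p 1)) = 0
  rw [← ekOf_legal, dS_ekOf]
  obtain ⟨⟨s, m⟩, hc, h⟩ := p
  change s.card = 1 at hc
  change dZ K n d (∑ i ∈ s, sg K n s i • ((X i : Rp K n) • ekOf K n d 0 (s.erase i) m
      - (X (yB n i m) : Rp K n) • ekOf K n d 0 (s.erase i) (gB n i m))) = 0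
  obtain ⟨i, rfl⟩ := Finset.card_eq_one.mp (by simpa using hc)
  have : ({i} : Finset (Fin n)).erase i = ∅ := by simp
  simp only [Finset.sum_singleton, this, map_smul, map_sub, dZ_ekOf]
  have h := congrArg (mprod K n) (gB_total n i m)
  simp only [mprod, Multiset.map_cons, Multiset.prod_cons] at h
  simp [mprod, h]

/-! ### Homotopy -/

abbrev mon (a : Fin n →₀ ℕ) : Rp K n := monomial a (1 : K)

def wt {d : ℕ} (m : Sym (Fin n) (d+1)) : ℕ := ((m : Multiset (Fin n)).map (fun i : Fin n => (i : ℕ))).sum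

lemma wt_rowSwap {d : ℕ} (i : Fin n) (m : Sym (Fin n) (d+1)) (h : i < maxSym n m) :
    wt n (rowSwap n i m) < wt n m := by
  have h1 := congrArg (fun s : Multiset (Fin n) => (s.map (fun i : Fin n => (i : ℕ))).sum)
    (Multiset.cons_erase (maxSym_mem n m))
  simp only [Multiset.map_cons, Multiset.sum_cons] at h1
  unfold wt
  rw [rowSwap_coe, Multiset.map_cons, Multiset.sum_cons]
  have : (i : ℕ) < (maxSym n m : ℕ) := h
  omega

def hS {d : ℕ} (s : Finset (Fin n)) (m : Sym (Fin n) (d+1)) (a : Fin n →₀ ℕ) : Finset (Fin n) :=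
  Finset.univ.filter (fun i => (i < maxSym n m ∧ a i ≠ 0) ∨ i ∈ s)

def hE (d k : ℕ) (s : Finset (Fin n)) (m : Sym (Fin n) (d+1)) (a : Fin n →₀ ℕ) : Ek K n d (k+1) :=
  if h : (hS n s m a).Nonempty then
    if (hS n s m a).min' h ∈ s then 0
    else - (mon K n (a - Finsupp.single ((hS n s m a).min' h) 1) •
      ekOf K n d (k+1) (insert ((hS n s m a).min' h) s) m)
  else 0

lemma hE_out (d k : ℕ) (s : Finset (Fin n)) (m : Sym (Fin n) (d+1)) (a : Fin n →₀ ℕ) (t : Fin n)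
    (ht : t < maxSym n m) (hat : a t ≠ 0) (hts : t ∉ s)
    (h1 : ∀ i, i < maxSym n m → a i ≠ 0 → t ≤ i) (h2 : ∀ i ∈ s, t ≤ i) :
    hE K n d k s m a = - (mon K n (a - Finsupp.single t 1) • ekOf K n d (k+1) (insert t s) m) := by
  have hmem : t ∈ hS n s m a := by simp [hS, ht, hat]
  have hmin : (hS n s m a).min' ⟨t, hmem⟩ = t := by
    apply le_antisymm (Finset.min'_le _ _ hmem)
    apply Finset.le_min'
    intro y hy
    simp only [hS, Finset.mem_filter, Finset.mem_univ, true_and] at hy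
    rcases hy with hy | hy
    · exact h1 y hy.1 hy.2
    · exact h2 y hy
  unfold hE
  rw [dif_pos ⟨t, hmem⟩]
  simp only [hmin]
  rw [if_neg hts]

lemma hE_in (d k : ℕ) (s : Finset (Fin n)) (m : Sym (Fin n) (d+1)) (a : Fin n →₀ ℕ) (t : Fin n)
    (hts : t ∈ s)
    (h1 : ∀ i, i < maxSym n m → a i ≠ 0 → t ≤ i) (h2 : ∀ i ∈ s, t ≤ i) :
    hE K n d k s m a = 0 := by
  have hmem : t ∈ hS n s m a := by simp [hS, hts]
  have hmin : (hS n s m a).min' ⟨t, hmem⟩ = t := by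
    apply le_antisymm (Finset.min'_le _ _ hmem)
    apply Finset.le_min'
    intro y hy
    simp only [hS, Finset.mem_filter, Finset.mem_univ, true_and] at hy
    rcases hy with hy | hy
    · exact h1 y hy.1 hy.2
    · exact h2 y hy
  unfold hE
  rw [dif_pos ⟨t, hmem⟩]
  simp only [hmin]
  rw [if_pos hts]

def hh (d k : ℕ) : Ek K n d k →ₗ[K] Ek K n d (k+1) :=
  Finsupp.lsum K (fun p : EKIdx n d k =>
    (MvPolynomial.basisMonomials (Fin n) K).constr K (fun a => hE K n d k p.1.1 p.1.2 a))

lemma hh_single (d k : ℕ) (p : EKIdx n d k) (a : Fin n →₀ ℕ) :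
    hh K n d k (Finsupp.single p (mon K n a)) = hE K n d k p.1.1 p.1.2 a := by
  unfold hh
  rw [Finsupp.lsum_single]
  have := (MvPolynomial.basisMonomials (Fin n) K).constr_basis K
    (fun a => hE K n d k p.1.1 p.1.2 a) a
  rwa [MvPolynomial.coe_basisMonomials] at this

lemma hE_illegal (d k : ℕ) (s : Finset (Fin n)) (m : Sym (Fin n) (d+1)) (a : Fin n →₀ ℕ)
    (h : ¬ (s.card = k ∧ ∀ i ∈ s, i < maxSym n m)) : hE K n d k s m a = 0 := by
  unfold hE
  split_ifs with h1 h2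
  · rfl
  · rw [ekOf_zero, smul_zero, neg_zero]
    rintro ⟨hc, hl⟩
    rw [Finset.card_insert_of_notMem h2] at hc
    exact h ⟨by omega, fun i hi => hl i (Finset.mem_insert_of_mem hi)⟩
  · rfl

lemma hh_ekOf (d k : ℕ) (s : Finset (Fin n)) (m : Sym (Fin n) (d+1)) (a : Fin n →₀ ℕ) :
    hh K n d k (mon K n a • ekOf K n d k s m) = hE K n d k s m a := by
  by_cases h : s.card = k ∧ ∀ i ∈ s, i < maxSym n m
  · rw [ekOf_mkI K n d k s m h, Finsupp.smul_single, smul_eq_mul, mul_one, hh_single]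
    rfl
  · rw [ekOf_zero K n d k s m h, hE_illegal K n d k s m a h, smul_zero, map_zero]

def W (d k w : ℕ) : Submodule (Rp K n) (Ek K n d k) :=
  Finsupp.supported (Rp K n) (Rp K n) {p : EKIdx n d k | wt n p.1.2 < w}

lemma W_mono (d k : ℕ) {w w' : ℕ} (h : w ≤ w') : W K n d k w ≤ W K n d k w' :=
  Finsupp.supported_mono fun _ hp => lt_of_lt_of_le hp h

lemma ekOf_mem_W (d k : ℕ) {w : ℕ} (s : Finset (Fin n)) (m : Sym (Fin n) (d+1)) (h : wt n m < w) :
    ekOf K n d k s m ∈ W K n d k w := by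
  by_cases hl : s.card = k ∧ ∀ i ∈ s, i < maxSym n m
  · rw [ekOf_mkI K n d k s m hl]
    exact Finsupp.single_mem_supported _ _ h
  · rw [ekOf_zero K n d k s m hl]
    exact zero_mem _

lemma W_smulK (d k w : ℕ) (c : K) {z : Ek K n d k} (hz : z ∈ W K n d k w) :
    c • z ∈ W K n d k w := by
  rw [← algebraMap_smul (Rp K n) c z]
  exact Submodule.smul_mem _ _ hz

lemma hE_mem_W (d k : ℕ) {w : ℕ} (s : Finset (Fin n)) (m : Sym (Fin n) (d+1)) (a : Fin n →₀ ℕ)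
    (h : wt n m < w) : hE K n d k s m a ∈ W K n d (k+1) w := by
  unfold hE
  split_ifs
  · exact zero_mem _
  · exact neg_mem (Submodule.smul_mem _ _ (ekOf_mem_W K n d _ _ _ h))
  · exact zero_mem _

lemma W_induct (d k w : ℕ) {P : Ek K n d k → Prop} (h0 : P 0)
    (hadd : ∀ x y, P x → P y → P (x + y)) (hsmul : ∀ (c : K) x, P x → P (c • x))
    (hbase : ∀ (s : Finset (Fin n)) (m : Sym (Fin n) (d+1)) (a : Fin n →₀ ℕ),
      (s.card = k ∧ ∀ i ∈ s, i < maxSym n m) → wt n m < w → P (mon K n a • ekOf K n d k s m))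
    {z : Ek K n d k} (hz : z ∈ W K n d k w) : P z := by
  rw [← Finsupp.sum_single z]
  refine Finset.sum_induction _ P hadd h0 fun p hp => ?_
  have hw : wt n p.1.2 < w := by
    have := (Finsupp.mem_supported _ _).mp hz
    exact this hp
  rw [(z p).as_sum, ← Finsupp.singleAddHom_apply, map_sum]
  refine Finset.sum_induction _ P hadd h0 fun a _ => ?_
  have := hsmul (coeff a (z p)) _ (hbase p.1.1 p.1.2 a p.2 hw)
  rw [ekOf_legal] at this
  convert this using 1
  rw [Finsupp.singleAddHom_apply, Finsupp.smul_single, Finsupp.smul_single, smul_eq_mul, mul_one,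
    MvPolynomial.smul_monomial, smul_eq_mul, mul_one]

lemma hh_mem_W (d k : ℕ) {w : ℕ} {z : Ek K n d k} (hz : z ∈ W K n d k w) :
    hh K n d k z ∈ W K n d (k+1) w := by
  refine W_induct K n d k w (P := fun z => hh K n d k z ∈ W K n d (k+1) w) ?_ ?_ ?_ ?_ hz
  · simp
  · intro x y hx hy
    rw [map_add]; exact add_mem hx hy
  · intro c x hx
    rw [map_smul]; exact W_smulK K n d _ _ c hx
  · intro s m a _ h
    rw [hh_ekOf]; exact hE_mem_W K n d k s m a h

lemma sg_pm (s : Finset (Fin n)) (i : Fin n) : sg K n s i = 1 ∨ sg K n s i = -1 :=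
  neg_one_pow_eq_or _ _

lemma hh_sg (d k : ℕ) (s : Finset (Fin n)) (i : Fin n) (z : Ek K n d k) :
    hh K n d k (sg K n s i • z) = sg K n s i • hh K n d k z := by
  rcases sg_pm K n s i with h | h <;> rw [h]
  · simp
  · rw [neg_smul, neg_smul, one_smul, one_smul, map_neg]

lemma mon_mul_X (a : Fin n →₀ ℕ) (i : Fin n) :
    mon K n a * X i = mon K n (a + Finsupp.single i 1) := by
  rw [X, MvPolynomial.monomial_mul, mul_one]

/-- leading part of the differential -/
def dL (d k : ℕ) (s : Finset (Fin n)) (m : Sym (Fin n) (d+1)) (a : Fin n →₀ ℕ) : Ek K n d k :=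
  ∑ i ∈ s, sg K n s i • (mon K n (a + Finsupp.single i 1) • ekOf K n d k (s.erase i) m)

lemma dS_lead (d k : ℕ) (s : Finset (Fin n)) (m : Sym (Fin n) (d+1)) (a : Fin n →₀ ℕ)
    (h : s.card = k+1 ∧ ∀ i ∈ s, i < maxSym n m) :
    dS K n d k (mon K n a • ekOf K n d (k+1) s m) - dL K n d k s m a ∈ W K n d k (wt n m) := by
  have e : dS K n d k (mon K n a • ekOf K n d (k+1) s m) - dL K n d k s m a =
      - (mon K n a • ∑ i ∈ s, (sg K n s i * X (maxSym n m)) •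
        ekOf K n d k (s.erase i) (rowSwap n i m)) := by
    rw [map_smul, dS_legal K n d k s m h, smul_sub, sub_right_comm, sub_eq_neg_self.mpr]
    rw [dL, Finset.smul_sum, ← Finset.sum_sub_distrib]
    refine Finset.sum_eq_zero fun i _ => ?_
    rw [← mon_mul_X]
    module
  rw [e]
  refine neg_mem (Submodule.smul_mem _ _ (Submodule.sum_mem _ fun i hi => Submodule.smul_mem _ _ ?_))
  exact ekOf_mem_W K n d k _ _ (wt_rowSwap n i m (h.2 i hi))

lemma hh_dL (d k : ℕ) (s : Finset (Fin n)) (m : Sym (Fin n) (d+1)) (a : Fin n →₀ ℕ) :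
    hh K n d k (dL K n d k s m a) =
      ∑ i ∈ s, sg K n s i • hE K n d k (s.erase i) m (a + Finsupp.single i 1) := by
  rw [dL, map_sum]
  refine Finset.sum_congr rfl fun i _ => ?_
  rw [hh_sg, hh_ekOf]

lemma sg_min (s : Finset (Fin n)) (t : Fin n) (h : ∀ i ∈ s, t ≤ i) : sg K n s t = -1 := by
  unfold sg
  rw [Finset.filter_eq_empty_iff.mpr fun {i} hi => not_lt.mpr (h i hi)]
  simp

/-- case where the minimum is a fresh variable -/
lemma lead_out (d k : ℕ) (s : Finset (Fin n)) (m : Sym (Fin n) (d+1)) (a : Fin n →₀ ℕ) (t : Fin n)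
    (hat : a t ≠ 0) (hts : t ∉ s) (h2 : ∀ i ∈ s, t ≤ i) :
    - dL K n d k (insert t s) m (a - Finsupp.single t 1) = mon K n a • ekOf K n d k s m +
      ∑ i ∈ s, sg K n s i • (mon K n (a + Finsupp.single i 1 - Finsupp.single t 1) •
        ekOf K n d k (insert t (s.erase i)) m) := by
  have hle : Finsupp.single t 1 ≤ a := by
    rw [Finsupp.single_le_iff]; omega
  rw [dL, Finset.sum_insert hts, sg_min K n (insert t s) t (by
      intro i hi
      rcases Finset.mem_insert.mp hi with rfl | hi
      · exact le_rfl
      · exact h2 i hi),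
    Finset.erase_insert hts, tsub_add_cancel_of_le hle, neg_add, ← Finset.sum_neg_distrib]
  congr 1
  · simp
  · refine Finset.sum_congr rfl fun i hi => ?_
    have hne : t ≠ i := fun h => hts (h ▸ hi)
    have hlt : t < i := lt_of_le_of_ne (h2 i hi) hne
    have h3 := sg_erase_lt K n (insert t s) (Finset.mem_insert_self t s) hlt
    rw [Finset.erase_insert hts] at h3
    rw [h3, Finset.erase_insert_of_ne hne, neg_smul, tsub_add_eq_add_tsub hle]

lemma homotopy (d k : ℕ) (s : Finset (Fin n)) (m : Sym (Fin n) (d+1)) (a : Fin n →₀ ℕ)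
    (h : s.card = k+1 ∧ ∀ i ∈ s, i < maxSym n m) :
    dS K n d (k+1) (hh K n d (k+1) (mon K n a • ekOf K n d (k+1) s m)) +
      hh K n d k (dS K n d k (mon K n a • ekOf K n d (k+1) s m)) -
      mon K n a • ekOf K n d (k+1) s m ∈ W K n d (k+1) (wt n m) := by
  have hB := hh_mem_W K n d k (dS_lead K n d k s m a h)
  rw [map_sub, hh_dL] at hB
  rw [hh_ekOf]
  have hne : (hS n s m a).Nonempty := by
    obtain ⟨i, hi⟩ := Finset.card_pos.mp (by omega : 0 < s.card)
    exact ⟨i, by simp [hS, hi]⟩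
  obtain ⟨t, htS, hmin⟩ : ∃ t ∈ hS n s m a, ∀ i ∈ hS n s m a, t ≤ i :=
    ⟨_, Finset.min'_mem _ hne, fun i hi => Finset.min'_le _ _ hi⟩
  have h1 : ∀ i, i < maxSym n m → a i ≠ 0 → t ≤ i := fun i hi ha => hmin i (by simp [hS, hi, ha])
  have h2 : ∀ i ∈ s, t ≤ i := fun i hi => hmin i (by simp [hS, hi])
  have h1' : ∀ j ∈ s, ∀ i, i < maxSym n m → (a + Finsupp.single j 1 : Fin n →₀ ℕ) i ≠ 0 → t ≤ i := by
    intro j hj i hi ha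
    by_cases hij : i = j
    · subst hij; exact h2 i hj
    · apply h1 i hi
      rw [Finsupp.add_apply, Finsupp.single_apply, if_neg (Ne.symm hij), add_zero] at ha
      exact ha
  by_cases hts : t ∈ s
  · rw [hE_in K n d (k+1) s m a t hts h1 h2, map_zero, zero_add]
    convert hB using 2
    symm
    rw [Finset.sum_eq_single_of_mem t hts]
    · rw [sg_min K n s t h2, hE_out K n d k (s.erase t) m _ t (h.2 t hts) (by simp) (by simp)
        (h1' t hts) (fun i hi => h2 i (Finset.mem_of_mem_erase hi)), Finset.insert_erase hts,
        add_tsub_cancel_right]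
      simp
    · intro i hi hit
      rw [hE_in K n d k (s.erase i) m _ t (Finset.mem_erase.mpr ⟨Ne.symm hit, hts⟩) (h1' i hi)
        (fun j hj => h2 j (Finset.mem_of_mem_erase hj)), smul_zero]
  · have htS' : t < maxSym n m ∧ a t ≠ 0 := by
      simpa [hS, hts] using htS
    obtain ⟨htM, hat⟩ := htS'
    rw [hE_out K n d (k+1) s m a t htM hat hts h1 h2, map_neg]
    have hA := neg_mem (dS_lead K n d (k+1) (insert t s) m (a - Finsupp.single t 1)
      ⟨by rw [Finset.card_insert_of_notMem hts, h.1], by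
        intro i hi
        rcases Finset.mem_insert.mp hi with rfl | hi
        · exact htM
        · exact h.2 i hi⟩)
    have hC := add_mem hA hB
    convert hC using 1
    have e1 : ∑ i ∈ s, sg K n s i • hE K n d k (s.erase i) m (a + Finsupp.single i 1) =
      - ∑ i ∈ s, sg K n s i • (mon K n (a + Finsupp.single i 1 - Finsupp.single t 1) •
        ekOf K n d (k+1) (insert t (s.erase i)) m) := by
      rw [← Finset.sum_neg_distrib]
      refine Finset.sum_congr rfl fun i hi => ?_
      rw [hE_out K n d k (s.erase i) m _ t htM (by simp [hat])
        (fun hh => hts (Finset.mem_of_mem_erase hh)) (h1' i hi)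
        (fun j hj => h2 j (Finset.mem_of_mem_erase hj)), smul_neg]
    have e2 := lead_out K n d (k+1) s m a t hat hts h2
    rw [e1]
    have e3 : dL K n d (k+1) (insert t s) m (a - Finsupp.single t 1) =
      - (mon K n a • ekOf K n d (k+1) s m + ∑ i ∈ s, sg K n s i •
        (mon K n (a + Finsupp.single i 1 - Finsupp.single t 1) •
        ekOf K n d (k+1) (insert t (s.erase i)) m)) := by rw [← e2, neg_neg]
    rw [e3]
    abel

lemma homotopy0 (d : ℕ) (m : Sym (Fin n) (d+1)) (a : Fin n →₀ ℕ) (t : Fin n)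
    (ht : t < maxSym n m) (hat : a t ≠ 0) :
    ∃ u, mon K n a • ekOf K n d 0 ∅ m - dS K n d 0 u ∈ W K n d 0 (wt n m) := by
  have hA := (dS_lead K n d 0 (insert t ∅) m (a - Finsupp.single t 1) ⟨by simp, by simpa using ht⟩)
  refine ⟨-(mon K n (a - Finsupp.single t 1) • ekOf K n d 1 (insert t ∅) m), ?_⟩
  convert hA using 1
  have e2 := lead_out K n d 0 ∅ m a t hat (by simp) (by simp)
  rw [Finset.sum_empty, add_zero] at e2
  rw [← e2, map_neg]
  abel

lemma W_zero (d k : ℕ) {z : Ek K n d k} (hz : z ∈ W K n d k 0) : z = 0 := by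
  have : {p : EKIdx n d k | wt n p.1.2 < 0} = ∅ := by ext; simp
  rw [W, this, Finsupp.supported_empty] at hz
  simpa using hz

lemma exists_W (d k : ℕ) (z : Ek K n d k) : ∃ w, z ∈ W K n d k w := by
  refine ⟨z.support.sup (fun p => wt n p.1.2) + 1, ?_⟩
  rw [W, Finsupp.mem_supported]
  intro p hp
  exact Nat.lt_succ_of_le (Finset.le_sup (f := fun p : EKIdx n d k => wt n p.1.2) hp)

lemma exactS (d k : ℕ) : LinearMap.ker (dS K n d k) = LinearMap.range (dS K n d (k+1)) := by
  apply le_antisymm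
  · have key : ∀ w, ∀ z ∈ W K n d (k+1) w, dS K n d k z = 0 → z ∈ LinearMap.range (dS K n d (k+1)) := by
      intro w
      induction w with
      | zero =>
        intro z hz _
        rw [W_zero K n d _ hz]; exact zero_mem _
      | succ w ih =>
        intro z hz hdz
        have hN : dS K n d (k+1) (hh K n d (k+1) z) + hh K n d k (dS K n d k z) - z ∈
            W K n d (k+1) w := by
          refine W_induct K n d (k+1) (w+1) (P := fun z => dS K n d (k+1) (hh K n d (k+1) z) +
            hh K n d k (dS K n d k z) - z ∈ W K n d (k+1) w) ?_ ?_ ?_ ?_ hz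
          · simp
          · intro x y hx hy
            convert add_mem hx hy using 1
            simp only [map_add]
            abel
          · intro c x hx
            convert W_smulK K n d _ _ c hx using 1
            rw [smul_sub, smul_add, LinearMap.map_smul, LinearMap.map_smul_of_tower,
              LinearMap.map_smul_of_tower, LinearMap.map_smul]
          · intro s m a h hw
            exact W_mono K n d _ (Nat.le_of_lt_succ hw) (homotopy K n d k s m a h)
        rw [hdz, map_zero, add_zero] at hN
        have hd : dS K n d k (dS K n d (k+1) (hh K n d (k+1) z) - z) = 0 := by
          have := LinearMap.congr_fun (dS_dS K n d k) (hh K n d (k+1) z)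
          rw [LinearMap.comp_apply, LinearMap.zero_apply] at this
          rw [map_sub, this, hdz, sub_zero]
        have := ih _ hN hd
        have h3 := sub_mem (LinearMap.mem_range_self (dS K n d (k+1)) (hh K n d (k+1) z)) this
        rwa [sub_sub_cancel] at h3
    intro z hz
    obtain ⟨w, hw⟩ := exists_W K n d (k+1) z
    exact key w z hw hz
  · exact LinearMap.range_le_ker_iff.mpr (dS_dS K n d k)

/-! ### Degree zero -/

def Red (d : ℕ) : Submodule K (Ek K n d 0) :=
  Submodule.span K {z | ∃ (a : Fin n →₀ ℕ) (m : Sym (Fin n) (d+1)),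
    (∀ i, i < maxSym n m → a i = 0) ∧ z = mon K n a • ekOf K n d 0 ∅ m}

lemma to_Red (d w : ℕ) : ∀ z ∈ W K n d 0 w, ∃ y ∈ Red K n d, ∃ u, z - y = dS K n d 0 u := by
  induction w with
  | zero =>
    intro z hz
    exact ⟨0, zero_mem _, 0, by rw [W_zero K n d _ hz]; simp⟩
  | succ w ih =>
    intro z hz
    refine W_induct K n d 0 (w+1) (P := fun z => ∃ y ∈ Red K n d, ∃ u, z - y = dS K n d 0 u)
      ⟨0, zero_mem _, 0, by simp⟩ ?_ ?_ ?_ hz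
    · rintro x x' ⟨y, hy, u, h⟩ ⟨y', hy', u', h'⟩
      exact ⟨y + y', add_mem hy hy', u + u', by rw [map_add, ← h, ← h']; abel⟩
    · rintro c x ⟨y, hy, u, h⟩
      exact ⟨c • y, Submodule.smul_mem _ _ hy, c • u, by
        rw [LinearMap.map_smul_of_tower, ← h, smul_sub]⟩
    · intro s m a h hw
      obtain rfl : s = ∅ := Finset.card_eq_zero.mp h.1
      by_cases hr : ∀ i, i < maxSym n m → a i = 0
      · exact ⟨_, Submodule.subset_span ⟨a, m, hr, rfl⟩, 0, by simp⟩
      · push Not at hr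
        obtain ⟨t, ht, hat⟩ := hr
        obtain ⟨u, hu⟩ := homotopy0 K n d m a t ht hat
        obtain ⟨y, hy, u', h'⟩ := ih _ (W_mono K n d _ (Nat.le_of_lt_succ hw) hu)
        exact ⟨y, hy, u + u', by rw [map_add, ← h']; abel⟩

lemma mprod_eq (m : Multiset (Fin n)) : mprod K n m = mon K n (Multiset.toFinsupp m) := by
  unfold mprod
  induction m using Multiset.induction_on with
  | empty => simp; rfl
  | cons i s ih =>
    rw [Multiset.map_cons, Multiset.prod_cons, ih, mul_comm, mon_mul_X, ← Multiset.singleton_add,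
      map_add, Multiset.toFinsupp_singleton, add_comm]

lemma dZ_mon (d : ℕ) (m : Sym (Fin n) (d+1)) (a : Fin n →₀ ℕ) :
    dZ K n d (mon K n a • ekOf K n d 0 ∅ m) =
      mon K n (a + Multiset.toFinsupp (m : Multiset (Fin n))) := by
  rw [map_smul, dZ_ekOf, mprod_eq, smul_eq_mul, MvPolynomial.monomial_mul, mul_one]

lemma red_unique (d : ℕ) (m m' : Sym (Fin n) (d+1)) (a a' : Fin n →₀ ℕ)
    (h : ∀ i, i < maxSym n m → a i = 0) (h' : ∀ i, i < maxSym n m' → a' i = 0)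
    (e : a + Multiset.toFinsupp (m : Multiset (Fin n)) =
      a' + Multiset.toFinsupp (m' : Multiset (Fin n))) : a = a' ∧ m = m' := by
  have aux : ∀ (m : Sym (Fin n) (d+1)) (a : Fin n →₀ ℕ), (∀ i, i < maxSym n m → a i = 0) →
      ∀ x ∈ Finsupp.toMultiset a, ∀ y ∈ (m : Multiset (Fin n)), y ≤ x := by
    intro m a h x hx y hy
    refine (le_maxSym n m hy).trans (not_lt.mp fun hlt => ?_)
    rw [Finsupp.mem_toMultiset, Finsupp.mem_support_iff] at hx
    exact hx (h x hlt)
  have e' := congrArg Finsupp.toMultiset e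
  rw [map_add, map_add, Multiset.toFinsupp_toMultiset, Multiset.toFinsupp_toMultiset] at e'
  have hm := red_aux n (sym_ne_zero n m) (sym_ne_zero n m') (by simp) (aux m a h) (aux m' a' h') e'
  rw [hm] at e
  exact ⟨add_right_cancel e, Sym.coe_injective hm⟩

open Classical in
def hZ (d : ℕ) : Rp K n →ₗ[K] Ek K n d 0 :=
  (MvPolynomial.basisMonomials (Fin n) K).constr K (fun c =>
    if h : ∃ q : (Fin n →₀ ℕ) × Sym (Fin n) (d+1), (∀ i, i < maxSym n q.2 → q.1 i = 0) ∧
      q.1 + Multiset.toFinsupp (q.2 : Multiset (Fin n)) = c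
    then mon K n h.choose.1 • ekOf K n d 0 ∅ h.choose.2 else 0)

lemma hZ_dZ (d : ℕ) (m : Sym (Fin n) (d+1)) (a : Fin n →₀ ℕ)
    (h : ∀ i, i < maxSym n m → a i = 0) :
    hZ K n d (dZ K n d (mon K n a • ekOf K n d 0 ∅ m)) = mon K n a • ekOf K n d 0 ∅ m := by
  classical
  rw [dZ_mon]
  have hq : ∃ q : (Fin n →₀ ℕ) × Sym (Fin n) (d+1), (∀ i, i < maxSym n q.2 → q.1 i = 0) ∧
      q.1 + Multiset.toFinsupp (q.2 : Multiset (Fin n)) =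
        a + Multiset.toFinsupp (m : Multiset (Fin n)) := ⟨(a, m), h, rfl⟩
  have := (MvPolynomial.basisMonomials (Fin n) K).constr_basis K (fun c =>
    if h : ∃ q : (Fin n →₀ ℕ) × Sym (Fin n) (d+1), (∀ i, i < maxSym n q.2 → q.1 i = 0) ∧
      q.1 + Multiset.toFinsupp (q.2 : Multiset (Fin n)) = c
    then mon K n h.choose.1 • ekOf K n d 0 ∅ h.choose.2 else 0)
    (a + Multiset.toFinsupp (m : Multiset (Fin n)))
  rw [MvPolynomial.coe_basisMonomials, dif_pos hq] at this
  obtain ⟨h1, h2⟩ := red_unique n d _ m _ a hq.choose_spec.1 h hq.choose_spec.2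
  rw [h1, h2] at this
  rw [← this]
  unfold hZ
  congr!

lemma hZ_dZ_Red (d : ℕ) {y : Ek K n d 0} (hy : y ∈ Red K n d) : hZ K n d (dZ K n d y) = y := by
  induction hy using Submodule.span_induction with
  | mem x hx =>
    obtain ⟨a, m, h, rfl⟩ := hx
    exact hZ_dZ K n d m a h
  | zero => simp
  | add x y _ _ hx hy => rw [map_add, map_add, hx, hy]
  | smul c x _ hx => rw [LinearMap.map_smul_of_tower, LinearMap.map_smul, hx]

lemma exactZ (d : ℕ) : LinearMap.ker (dZ K n d) = LinearMap.range (dS K n d 0) := by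
  apply le_antisymm
  · intro z hz
    obtain ⟨w, hw⟩ := exists_W K n d 0 z
    obtain ⟨y, hy, u, hu⟩ := to_Red K n d w z hw
    have h0 : dZ K n d y = 0 := by
      have := LinearMap.congr_fun (dZ_dS K n d) u
      rw [LinearMap.comp_apply, ← hu, map_sub, LinearMap.zero_apply, LinearMap.mem_ker.mp hz,
        zero_sub, neg_eq_zero] at this
      exact this
    have := hZ_dZ_Red K n d hy
    rw [h0, map_zero] at this
    rw [← this, sub_zero] at hu
    exact ⟨u, hu.symm⟩
  · exact LinearMap.range_le_ker_iff.mpr (dZ_dS K n d)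

/-! ### Ideal, minimality, homogeneity -/

lemma span_pow_aux (e : ℕ) : ((Ideal.span (Set.range (X : Fin n → Rp K n))) ^ e : Ideal (Rp K n)) =
    Ideal.span {f | ∃ m : Multiset (Fin n), m.card = e ∧ f = mprod K n m} := by
  induction e with
  | zero =>
    rw [pow_zero, Ideal.one_eq_top, eq_comm, Ideal.eq_top_iff_one]
    exact Ideal.subset_span ⟨0, rfl, by simp [mprod]⟩
  | succ e ih =>
    rw [pow_succ, ih, Ideal.span_mul_span']
    congr 1
    ext f
    simp only [Set.mem_mul, Set.mem_ofPred_eq, Set.mem_range]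
    constructor
    · rintro ⟨_, ⟨m, hm, rfl⟩, _, ⟨i, rfl⟩, rfl⟩
      exact ⟨i ::ₘ m, by simp [hm], by simp [mprod, mul_comm]⟩
    · rintro ⟨m, hm, rfl⟩
      obtain ⟨i, hi⟩ := Multiset.exists_mem_of_ne_zero (s := m) (by rintro rfl; simp at hm)
      obtain ⟨m', rfl⟩ := Multiset.exists_cons_of_mem hi
      exact ⟨_, ⟨m', by simpa using hm, rfl⟩, _, ⟨i, rfl⟩, by simp [mprod, mul_comm]⟩

lemma range_eq_span {ι R M : Type*} [CommRing R] [AddCommGroup M] [Module R M]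
    (f : (ι →₀ R) →ₗ[R] M) :
    LinearMap.range f = Submodule.span R (Set.range fun p => f (Finsupp.single p 1)) := by
  apply le_antisymm
  · rintro _ ⟨z, rfl⟩
    rw [← Finsupp.sum_single z, Finsupp.sum, map_sum]
    refine Submodule.sum_mem _ fun p _ => ?_
    have : Finsupp.single p (z p) = z p • Finsupp.single p (1 : R) := by simp
    rw [this, map_smul]
    exact Submodule.smul_mem _ _ (Submodule.subset_span ⟨p, rfl⟩)
  · rw [Submodule.span_le]
    rintro _ ⟨p, rfl⟩
    exact ⟨_, rfl⟩

lemma range_dZ (d : ℕ) : LinearMap.range (dZ K n d) =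
    ((Ideal.span (Set.range (X : Fin n → Rp K n))) ^ (d+1) : Ideal (Rp K n)) := by
  rw [range_eq_span, span_pow_aux]
  change Ideal.span _ = _
  congr 1
  ext f
  constructor
  · rintro ⟨p, rfl⟩
    exact ⟨p.1.2, Sym.card_coe, dZ_single K n d p⟩
  · rintro ⟨m, hm, rfl⟩
    have := dZ_ekOf K n d ⟨m, hm⟩
    rw [ekOf_mkI K n d 0 ∅ ⟨m, hm⟩ (by simp)] at this
    exact ⟨_, this⟩

lemma X_mem (i : Fin n) : (X i : Rp K n) ∈ Ideal.span (Set.range (X : Fin n → Rp K n)) :=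
  Ideal.subset_span ⟨i, rfl⟩

lemma minZ (d : ℕ) : LinearMap.range (dZ K n d) ≤
    (Ideal.span (Set.range (X : Fin n → Rp K n))) • (⊤ : Submodule (Rp K n) (Rp K n)) := by
  rw [range_dZ]
  have : (Ideal.span (Set.range (X : Fin n → Rp K n))) • (⊤ : Submodule (Rp K n) (Rp K n)) =
      Ideal.span (Set.range (X : Fin n → Rp K n)) := Ideal.mul_top _
  rw [this]
  exact Ideal.pow_le_self (by omega)

lemma minS (d k : ℕ) : LinearMap.range (dS K n d k) ≤
    (Ideal.span (Set.range (X : Fin n → Rp K n))) • (⊤ : Submodule (Rp K n) (Ek K n d k)) := by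
  rw [range_eq_span, Submodule.span_le]
  rintro _ ⟨p, rfl⟩
  simp only [dS_single]
  refine sub_mem (Submodule.sum_mem _ fun i _ => ?_) (Submodule.sum_mem _ fun i _ => ?_)
  · exact Submodule.smul_mem_smul (Ideal.mul_mem_left _ _ (X_mem K n i)) trivial
  · exact Submodule.smul_mem_smul (Ideal.mul_mem_left _ _ (X_mem K n _)) trivial

lemma homZ (d : ℕ) (p : EKIdx n d 0) : (dZ K n d (Finsupp.single p 1)).IsHomogeneous (d+1) := by
  rw [dZ_single, mprod_eq]
  apply MvPolynomial.isHomogeneous_monomial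
  have h := Finsupp.card_toMultiset (Multiset.toFinsupp (p.1.2 : Multiset (Fin n)))
  rw [Multiset.toFinsupp_toMultiset] at h
  exact h.symm.trans Sym.card_coe

lemma hom_term (d k : ℕ) (s s' : Finset (Fin n)) (i j : Fin n) (m : Sym (Fin n) (d+1))
    (q : EKIdx n d k) :
    (((sg K n s i * X j) • ekOf K n d k s' m) q).IsHomogeneous 1 := by
  classical
  have h1 : (sg K n s i * X j).IsHomogeneous 1 := by
    rcases sg_pm K n s i with h | h <;> rw [h]
    · rw [one_mul]; exact isHomogeneous_X _ _
    · rw [neg_one_mul]; exact (isHomogeneous_X _ _).neg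
  by_cases hl : s'.card = k ∧ ∀ i ∈ s', i < maxSym n m
  · rw [ekOf_mkI K n d k s' m hl, Finsupp.smul_single, smul_eq_mul, mul_one, Finsupp.single_apply]
    split_ifs
    · exact h1
    · exact isHomogeneous_zero _ _ _
  · rw [ekOf_zero K n d k s' m hl, smul_zero]
    exact isHomogeneous_zero _ _ _

lemma homS (d k : ℕ) (p : EKIdx n d (k+1)) (q : EKIdx n d k) :
    ((dS K n d k (Finsupp.single p 1)) q).IsHomogeneous 1 := by
  rw [dS_single, Finsupp.sub_apply, Finsupp.finsetSum_apply, Finsupp.finsetSum_apply]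
  refine IsHomogeneous.sub (IsHomogeneous.sum _ _ _ fun i _ => ?_)
    (IsHomogeneous.sum _ _ _ fun i _ => ?_)
  · exact hom_term K n d k _ _ _ _ _ q
  · exact hom_term K n d k _ _ _ _ _ q

/-- (Here the paper's exponent `d ≥ 1` is written `d+1`.)  The
sequence `EK_•` with the differential `d_EK` is a complex, and it is a minimal
homogeneous free resolution of `R/(x_1, …, x_n)^d`.  Explicitly:
* `d_EK ∘ d_EK = 0`;
* it is exact in positive homological degrees, and the image of `EK_1 → R` is the
  ideal `(x_1, …, x_n)^d`, so the complex resolves `R/(x_1, …, x_n)^d`;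
* minimality: all differentials have entries in `(x_1, …, x_n)`;
* homogeneity: all entries of the differentials are homogeneous polynomials (of
  degree `d` for `EK_1 → R`, and of degree `1` in higher homological degrees). -/
theorem EK_is_minimal_free_resolution (hn : 1 ≤ n) (d : ℕ) :
    -- EK_• is a complex
    (∀ k, (dEK K n d k).comp (dEK K n d (k+1)) = 0) ∧
    -- exactness at EK_{k+1} for every k
    (∀ k, LinearMap.ker (dEK K n d k) = LinearMap.range (dEK K n d (k+1))) ∧
    -- the cokernel of EK_1 → R is R/(x_1, …, x_n)^d
    (LinearMap.range (dEK K n d 0) =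
      ((Ideal.span (Set.range (X : Fin n → Rp K n))) ^ (d+1) : Ideal (Rp K n))) ∧
    -- minimality
    (∀ k, LinearMap.range (dEK K n d k) ≤
      (Ideal.span (Set.range (X : Fin n → Rp K n))) • (⊤ : Submodule (Rp K n) (EKmod K n d k))) ∧
    -- homogeneity
    (∀ p : EKIdx n d 0,
      ((dEK K n d 0) (Finsupp.single p 1) : MvPolynomial (Fin n) K).IsHomogeneous (d+1)) ∧
    (∀ k (p : EKIdx n d (k+1)) (q : EKIdx n d k),
      ((show EKIdx n d k →₀ Rp K n from (dEK K n d (k+1)) (Finsupp.single p 1)) q).IsHomogeneous 1) := by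
  refine ⟨?_, ?_, range_dZ K n d, ?_, homZ K n d, homS K n d⟩
  · rintro (_ | k)
    · exact dZ_dS K n d
    · exact dS_dS K n d k
  · rintro (_ | k)
    · exact exactZ K n d
    · exact exactS K n d k
  · rintro (_ | k)
    · exact minZ K n d
    · exact minS K n d k

end
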